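/- There is a constant C > 0 depending only on m with the following property. Fix d, m, L ∈ ℕ with m ≥ 2 (so every network in the class is continuously differentiable), an architecture (d₀ = d, d₁, …, d_L, d_{L+1} = 1) with size 𝒮, and K, u > 0. Define the metric ρ_∞(g, g̃) = sup_{x ∈ [0,1]^d} ( |g(x) − g̃(x)| + ‖∇g(x) − ∇g̃(x)‖₁ ). Then there exists a finite set T of continuously differentiable functions on [0,1]^d with |T| ≤ exp( C·𝒮·log(1 + L·K·m^L/u) ) such that every g ∈ 𝒩_K admits some g̃ ∈ T with ρ_∞(g, g̃) ≤ u. -/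

import Mathlib

/-- RePU activation of order `m`: `σ_m(t) = (max{t,0})^m`. -/
noncomputable def repu (m : ℕ) (t : ℝ) : ℝ := (max t 0) ^ m

/-- Hidden-layer forward pass of a RePU network with architecture `arch`
(`arch 0` input units, `arch ℓ` units at layer `ℓ`), weight matrices `A` and biases `b`:
`netFwd m arch A b x ℓ` is the output of the `ℓ`-th hidden layer at input `x`. -/
noncomputable def netFwd (m : ℕ) (arch : ℕ → ℕ)
    (A : ∀ ℓ : ℕ, Matrix (Fin (arch (ℓ + 1))) (Fin (arch ℓ)) ℝ)
    (b : ∀ ℓ : ℕ, Fin (arch (ℓ + 1)) → ℝ)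
    (x : Fin (arch 0) → ℝ) : (ℓ : ℕ) → Fin (arch ℓ) → ℝ
  | 0 => x
  | ℓ + 1 => fun i => repu m ((A ℓ).mulVec (netFwd m arch A b x ℓ) i + b ℓ i)

/-- Real output of a depth-`L` RePU network (the output layer `g_L(x) = A_L x` has one
unit, `arch (L+1) = 1`; we sum the coordinates of the output vector). -/
noncomputable def netOut (m : ℕ) (arch : ℕ → ℕ)
    (A : ∀ ℓ : ℕ, Matrix (Fin (arch (ℓ + 1))) (Fin (arch ℓ)) ℝ)
    (b : ∀ ℓ : ℕ, Fin (arch (ℓ + 1)) → ℝ) (L : ℕ) (x : Fin (arch 0) → ℝ) : ℝ :=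
  ∑ i, (A L).mulVec (netFwd m arch A b x L) i

/-- The `ℓ∞` operator norm of a matrix: `‖A‖_∞ = max_i Σ_j |a_{ij}|`. -/
noncomputable def matInfNorm {p q : ℕ} (A : Matrix (Fin p) (Fin q) ℝ) : ℝ :=
  ⨆ i, ∑ j, |A i j|

/-- `‖(A, b)‖_∞`, the `ℓ∞` operator norm of `A` augmented with the column `b`. -/
noncomputable def augInfNorm {p q : ℕ} (A : Matrix (Fin p) (Fin q) ℝ) (b : Fin p → ℝ) : ℝ :=
  ⨆ i, ((∑ j, |A i j|) + |b i|)

/-- Norm-constraint functional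
`κ(θ) = m^L ‖A_L‖_∞ ∏_{s=0}^{L−1} max{‖(A_s, b_s)‖_∞, 1}^{m^{L−s}}`. -/
noncomputable def kappa (m L : ℕ) (arch : ℕ → ℕ)
    (A : ∀ ℓ : ℕ, Matrix (Fin (arch (ℓ + 1))) (Fin (arch ℓ)) ℝ)
    (b : ∀ ℓ : ℕ, Fin (arch (ℓ + 1)) → ℝ) : ℝ :=
  (m : ℝ) ^ L * matInfNorm (A L) *
    ∏ s ∈ Finset.range L, (max (augInfNorm (A s) (b s)) 1) ^ (m ^ (L - s))

/-- The size `𝒮 = Σ_{s=0}^{L−1} d_{s+1}(d_s + 1)` of an architecture. -/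
def netSize (arch : ℕ → ℕ) (L : ℕ) : ℕ :=
  ∑ s ∈ Finset.range L, arch (s + 1) * (arch s + 1)

/-- The class `𝒩_K` of RePU networks of order `m`, depth `L`, fixed architecture `arch`,
with norm constraint `κ(θ) ≤ K`. -/
def NNclassArch (m L : ℕ) (arch : ℕ → ℕ) (K : ℝ) : Set ((Fin (arch 0) → ℝ) → ℝ) :=
  { g | ∃ A b, kappa m L arch A b ≤ K ∧ g = netOut m arch A b L }


/-- The `ℓ¹`-norm of the coefficient vector of a linear functional on `ℝ^d`. -/
noncomputable def coordNorm {d : ℕ} (φ : (Fin d → ℝ) →L[ℝ] ℝ) : ℝ :=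
  ∑ i, |φ (Pi.single i 1)|

theorem coordNorm_nonneg {d : ℕ} (φ : (Fin d → ℝ) →L[ℝ] ℝ) : 0 ≤ coordNorm φ :=
  Finset.sum_nonneg fun _ _ => abs_nonneg _

theorem coordNorm_zero {d : ℕ} : coordNorm (0 : (Fin d → ℝ) →L[ℝ] ℝ) = 0 := by
  simp [coordNorm]

theorem coordNorm_add_le {d : ℕ} (φ ψ : (Fin d → ℝ) →L[ℝ] ℝ) :
    coordNorm (φ + ψ) ≤ coordNorm φ + coordNorm ψ := by
  simp only [coordNorm, ← Finset.sum_add_distrib]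
  exact Finset.sum_le_sum fun i _ => by simpa using abs_add_le _ _

theorem coordNorm_smul {d : ℕ} (c : ℝ) (φ : (Fin d → ℝ) →L[ℝ] ℝ) :
    coordNorm (c • φ) = |c| * coordNorm φ := by
  simp [coordNorm, Finset.mul_sum, abs_mul]

theorem coordNorm_sum_smul_le {d : ℕ} {ι : Type*} [Fintype ι] (r : ι → ℝ)
    (φ : ι → (Fin d → ℝ) →L[ℝ] ℝ) {B : ℝ} (hφ : ∀ j, coordNorm (φ j) ≤ B) :
    coordNorm (∑ j, r j • φ j) ≤ (∑ j, |r j|) * B := by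
  have key : ∀ s : Finset ι, coordNorm (∑ j ∈ s, r j • φ j) ≤ ∑ j ∈ s, |r j| * B := by
    intro s
    refine Finset.le_sum_of_subadditive coordNorm coordNorm_zero.le coordNorm_add_le s _ |>.trans ?_
    refine Finset.sum_le_sum fun j _ => ?_
    rw [coordNorm_smul]
    exact mul_le_mul_of_nonneg_left (hφ j) (abs_nonneg _)
  simpa [Finset.sum_mul] using key Finset.univ

theorem abs_sum_mul_le {ι : Type*} [Fintype ι] (r h : ι → ℝ) {B : ℝ} (hB : ∀ j, |h j| ≤ B) :
    |∑ j, r j * h j| ≤ (∑ j, |r j|) * B := by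
  rw [Finset.sum_mul]
  refine (Finset.abs_sum_le_sum_abs _ _).trans (Finset.sum_le_sum fun j _ => ?_)
  rw [abs_mul]
  exact mul_le_mul_of_nonneg_left (hB j) (abs_nonneg _)

/-- A family of `C¹` functions which on the unit cube are bounded by `1` and have gradients of
`ℓ¹`-norm at most `G`. -/
structure IsBoundedFamily {d : ℕ} {ι : Type*} (G : ℝ) (H : (Fin d → ℝ) → ι → ℝ) : Prop where
  contDiff : ∀ j, ContDiff ℝ 1 fun x => H x j
  abs_le : ∀ x ∈ Set.Icc (0 : Fin d → ℝ) 1, ∀ j, |H x j| ≤ 1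
  grad_le : ∀ x ∈ Set.Icc (0 : Fin d → ℝ) 1, ∀ j, coordNorm (fderiv ℝ (fun y => H y j) x) ≤ G

/-- Two families of functions are `e`-close in value and `D`-close in gradient on the cube. -/
structure FamilyClose {d : ℕ} {ι : Type*} (e D : ℝ) (H H' : (Fin d → ℝ) → ι → ℝ) : Prop where
  abs_le : ∀ x ∈ Set.Icc (0 : Fin d → ℝ) 1, ∀ j, |H x j - H' x j| ≤ e
  grad_le : ∀ x ∈ Set.Icc (0 : Fin d → ℝ) 1, ∀ j,
    coordNorm (fderiv ℝ (fun y => H y j) x - fderiv ℝ (fun y => H' y j) x) ≤ D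

/-- A family of functions together with the constant function `1`. -/
def augment {d : ℕ} {ι : Type*} (H : (Fin d → ℝ) → ι → ℝ) (x : Fin d → ℝ) (o : Option ι) : ℝ :=
  o.elim 1 (H x)

theorem IsBoundedFamily.augment {d : ℕ} {ι : Type*} {G : ℝ} {H : (Fin d → ℝ) → ι → ℝ}
    (hG : 0 ≤ G) (h : IsBoundedFamily G H) : IsBoundedFamily G (augment H) where
  contDiff := by
    rintro (_ | j)
    · exact contDiff_const
    · exact h.contDiff j
  abs_le := by
    rintro x hx (_ | j)
    · simp [_root_.augment]
    · exact h.abs_le x hx j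
  grad_le := by
    rintro x hx (_ | j)
    · simpa [_root_.augment, coordNorm_zero] using hG
    · exact h.grad_le x hx j

theorem FamilyClose.augment {d : ℕ} {ι : Type*} {e D : ℝ} {H H' : (Fin d → ℝ) → ι → ℝ}
    (he : 0 ≤ e) (hD : 0 ≤ D) (h : FamilyClose e D H H') :
    FamilyClose e D (augment H) (augment H') where
  abs_le := by
    rintro x hx (_ | j)
    · simpa [_root_.augment] using he
    · exact h.abs_le x hx j
  grad_le := by
    rintro x hx (_ | j)
    · simpa [_root_.augment, coordNorm_zero] using hD
    · exact h.grad_le x hx j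

/-- The linear combination of a family of functions with coefficients `r`. -/
def linComb {d : ℕ} {ι : Type*} [Fintype ι] (r : ι → ℝ) (H : (Fin d → ℝ) → ι → ℝ)
    (x : Fin d → ℝ) : ℝ :=
  ∑ j, r j * H x j

section LinComb

variable {d : ℕ} {ι : Type*} [Fintype ι] {G e D ε : ℝ} {r r' : ι → ℝ}
  {H H' : (Fin d → ℝ) → ι → ℝ}

theorem contDiff_linComb (h : IsBoundedFamily G H) : ContDiff ℝ 1 (linComb r H) :=
  ContDiff.sum fun j _ => contDiff_const.mul (h.contDiff j)

theorem fderiv_linComb (h : IsBoundedFamily G H) (x : Fin d → ℝ) :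
    fderiv ℝ (linComb r H) x = ∑ j, r j • fderiv ℝ (fun y => H y j) x := by
  have hd : ∀ j, HasFDerivAt (fun y => r j * H y j) (r j • fderiv ℝ (fun y => H y j) x) x :=
    fun j => (((h.contDiff j).differentiable one_ne_zero x).hasFDerivAt).const_mul (r j)
  exact (HasFDerivAt.fun_sum fun j _ => hd j).fderiv

theorem abs_linComb_le (h : IsBoundedFamily G H) {x : Fin d → ℝ}
    (hx : x ∈ Set.Icc (0 : Fin d → ℝ) 1) : |linComb r H x| ≤ ∑ j, |r j| := by
  simpa [linComb] using abs_sum_mul_le r (H x) (h.abs_le x hx)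

theorem coordNorm_fderiv_linComb_le (h : IsBoundedFamily G H) {x : Fin d → ℝ}
    (hx : x ∈ Set.Icc (0 : Fin d → ℝ) 1) :
    coordNorm (fderiv ℝ (linComb r H) x) ≤ (∑ j, |r j|) * G := by
  rw [fderiv_linComb h]
  exact coordNorm_sum_smul_le r _ (h.grad_le x hx)

theorem abs_linComb_sub_le (h' : IsBoundedFamily G H') (hc : FamilyClose e D H H')
    {x : Fin d → ℝ} (hx : x ∈ Set.Icc (0 : Fin d → ℝ) 1) :
    |linComb r H x - linComb r' H' x| ≤ (∑ j, |r j|) * e + ∑ j, |r j - r' j| := by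
  have hsplit : linComb r H x - linComb r' H' x
      = ∑ j, r j * (H x j - H' x j) + linComb (fun j => r j - r' j) H' x := by
    simp only [linComb, ← Finset.sum_sub_distrib, ← Finset.sum_add_distrib]
    exact Finset.sum_congr rfl fun j _ => by ring
  rw [hsplit]
  exact (abs_add_le _ _).trans
    (add_le_add (abs_sum_mul_le r _ (hc.abs_le x hx)) (abs_linComb_le h' hx))

theorem coordNorm_fderiv_linComb_sub_le (h : IsBoundedFamily G H) (h' : IsBoundedFamily G H')
    (hc : FamilyClose e D H H') {x : Fin d → ℝ} (hx : x ∈ Set.Icc (0 : Fin d → ℝ) 1) :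
    coordNorm (fderiv ℝ (linComb r H) x - fderiv ℝ (linComb r' H') x)
      ≤ (∑ j, |r j|) * D + (∑ j, |r j - r' j|) * G := by
  have hsplit : fderiv ℝ (linComb r H) x - fderiv ℝ (linComb r' H') x
      = ∑ j, r j • (fderiv ℝ (fun y => H y j) x - fderiv ℝ (fun y => H' y j) x)
        + ∑ j, (r j - r' j) • fderiv ℝ (fun y => H' y j) x := by
    rw [fderiv_linComb h, fderiv_linComb h']
    simp only [← Finset.sum_sub_distrib, ← Finset.sum_add_distrib]
    exact Finset.sum_congr rfl fun j _ => by module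
  rw [hsplit]
  exact (coordNorm_add_le _ _).trans
    (add_le_add (coordNorm_sum_smul_le r _ (hc.grad_le x hx))
      (coordNorm_sum_smul_le _ _ (h'.grad_le x hx)))

end LinComb

theorem hasDerivAt_repu {m : ℕ} (hm : 2 ≤ m) (t : ℝ) :
    HasDerivAt (repu m) (m * max t 0 ^ (m - 1)) t := by
  have hne : ∀ t : ℝ, t ≠ 0 → HasDerivAt (repu m) (m * max t 0 ^ (m - 1)) t := by
    intro t ht
    rcases lt_or_gt_of_ne ht with h | h
    · rw [max_eq_right h.le, zero_pow (by omega), mul_zero]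
      refine (hasDerivAt_const t (0 : ℝ)).congr_of_eventuallyEq ?_
      filter_upwards [gt_mem_nhds h] with s hs
      rw [repu, max_eq_right hs.le, zero_pow (by omega)]
    · rw [max_eq_left h.le]
      refine (hasDerivAt_pow m t).congr_of_eventuallyEq ?_
      filter_upwards [lt_mem_nhds h] with s hs
      rw [repu, max_eq_left hs.le]
  rcases eq_or_ne t 0 with rfl | ht
  · refine hasDerivAt_of_hasDerivAt_of_ne (fun y hy => hne y hy) ?_ ?_
    · unfold repu; fun_prop
    · fun_prop
  · exact hne t ht

theorem contDiff_repu {m : ℕ} (hm : 2 ≤ m) : ContDiff ℝ 1 (repu m) := by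
  rw [contDiff_one_iff_deriv]
  refine ⟨fun t => (hasDerivAt_repu hm t).differentiableAt, ?_⟩
  rw [funext fun t => (hasDerivAt_repu hm t).deriv]
  fun_prop

theorem max_zero_pow_le_one {t : ℝ} (ht : |t| ≤ 1) (k : ℕ) : max t 0 ^ k ≤ 1 :=
  pow_le_one₀ (le_max_right _ _) (max_le (abs_le.1 ht).2 zero_le_one)

theorem abs_max_zero_pow_sub_le {s t : ℝ} (hs : |s| ≤ 1) (ht : |t| ≤ 1) (k : ℕ) :
    |max s 0 ^ k - max t 0 ^ k| ≤ k * |s - t| := by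
  have h1 : ∀ {r : ℝ}, |r| ≤ 1 → |max r 0| ≤ 1 := fun {r} hr =>
    abs_le.2 ⟨by linarith [le_max_right r 0], max_le (abs_le.1 hr).2 zero_le_one⟩
  have h2 : |max s 0 - max t 0| ≤ |s - t| := by
    simpa using abs_max_sub_max_le_abs s t 0
  have h3 : max |max s 0| |max t 0| ^ (k - 1) ≤ 1 :=
    pow_le_one₀ (le_max_of_le_left (abs_nonneg _)) (max_le (h1 hs) (h1 ht))
  calc |max s 0 ^ k - max t 0 ^ k|
      ≤ |max s 0 - max t 0| * k * max |max s 0| |max t 0| ^ (k - 1) := abs_pow_sub_pow_le ..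
    _ ≤ |s - t| * k * 1 := by gcongr
    _ = k * |s - t| := by ring

/-- A hidden layer of RePU units with weight rows `R` (biases at `none`) applied to a family. -/
noncomputable def repuLayer {d : ℕ} {ι κ : Type*} [Fintype ι] (m : ℕ) (R : κ → Option ι → ℝ)
    (H : (Fin d → ℝ) → ι → ℝ) (x : Fin d → ℝ) (i : κ) : ℝ :=
  repu m (linComb (R i) (augment H) x)

section Layer

variable {d m : ℕ} {ι κ : Type*} [Fintype ι] {G e D ε : ℝ} {R R' : κ → Option ι → ℝ}
  {H H' : (Fin d → ℝ) → ι → ℝ}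

theorem fderiv_repuLayer (hm : 2 ≤ m) (hG : 0 ≤ G) (h : IsBoundedFamily G H) (x : Fin d → ℝ)
    (i : κ) :
    fderiv ℝ (fun y => repuLayer m R H y i) x
      = (m * max (linComb (R i) (augment H) x) 0 ^ (m - 1)) •
        fderiv ℝ (linComb (R i) (augment H)) x :=
  ((hasDerivAt_repu hm _).comp_hasFDerivAt x
    ((contDiff_linComb (h.augment hG)).differentiable one_ne_zero x).hasFDerivAt).fderiv

theorem IsBoundedFamily.repuLayer (hm : 2 ≤ m) (hG : 0 ≤ G) (h : IsBoundedFamily G H)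
    (hR : ∀ i, ∑ o, |R i o| ≤ 1) : IsBoundedFamily (m * G) (repuLayer m R H) where
  contDiff i := (contDiff_repu hm).comp (contDiff_linComb (h.augment hG))
  abs_le x hx i := by
    have hz := (abs_linComb_le (r := R i) (h.augment hG) hx).trans (hR i)
    have h0 : 0 ≤ max (linComb (R i) (_root_.augment H) x) 0 ^ m := pow_nonneg (le_max_right _ _) _
    exact (abs_of_nonneg h0).le.trans (max_zero_pow_le_one hz m)
  grad_le x hx i := by
    have hz := (abs_linComb_le (r := R i) (h.augment hG) hx).trans (hR i)
    have hp := max_zero_pow_le_one hz (m - 1)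
    have h0 : 0 ≤ max (linComb (R i) (_root_.augment H) x) 0 ^ (m - 1) :=
      pow_nonneg (le_max_right _ _) _
    have hg := coordNorm_fderiv_linComb_le (r := R i) (h.augment hG) hx
    have hg' : coordNorm (fderiv ℝ (linComb (R i) (_root_.augment H)) x) ≤ G :=
      hg.trans (mul_le_of_le_one_left hG (hR i))
    rw [fderiv_repuLayer hm hG h, coordNorm_smul, abs_of_nonneg (by positivity)]
    calc _ ≤ (m * 1 : ℝ) * G := by gcongr; exact coordNorm_nonneg _
      _ = m * G := by ring

theorem FamilyClose.repuLayer (hm : 2 ≤ m) (hG : 0 ≤ G) (he : 0 ≤ e) (hD : 0 ≤ D)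
    (h : IsBoundedFamily G H) (h' : IsBoundedFamily G H') (hc : FamilyClose e D H H')
    (hR : ∀ i, ∑ o, |R i o| ≤ 1) (hR' : ∀ i, ∑ o, |R' i o| ≤ 1)
    (hRR : ∀ i, ∑ o, |R i o - R' i o| ≤ ε) :
    FamilyClose (m * (e + ε)) (m * D + m ^ 2 * G * (e + ε)) (repuLayer m R H)
      (repuLayer m R' H') := by
  have hz : ∀ x ∈ Set.Icc (0 : Fin d → ℝ) 1, ∀ i,
      |linComb (R i) (_root_.augment H) x - linComb (R' i) (_root_.augment H') x| ≤ e + ε :=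
    fun x hx i => (abs_linComb_sub_le (h'.augment hG) (hc.augment he hD) hx).trans
      (add_le_add (mul_le_of_le_one_left he (hR i)) (hRR i))
  have hz1 : ∀ x ∈ Set.Icc (0 : Fin d → ℝ) 1, ∀ i, |linComb (R i) (_root_.augment H) x| ≤ 1 :=
    fun x hx i => (abs_linComb_le (h.augment hG) hx).trans (hR i)
  have hz2 : ∀ x ∈ Set.Icc (0 : Fin d → ℝ) 1, ∀ i, |linComb (R' i) (_root_.augment H') x| ≤ 1 :=
    fun x hx i => (abs_linComb_le (h'.augment hG) hx).trans (hR' i)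
  refine ⟨fun x hx i => ?_, fun x hx i => ?_⟩
  · exact (abs_max_zero_pow_sub_le (hz1 x hx i) (hz2 x hx i) m).trans
      (mul_le_mul_of_nonneg_left (hz x hx i) (Nat.cast_nonneg m))
  · rw [fderiv_repuLayer hm hG h, fderiv_repuLayer hm hG h']
    have hp := max_zero_pow_le_one (hz1 x hx i) (m - 1)
    have hpp := abs_max_zero_pow_sub_le (hz1 x hx i) (hz2 x hx i) (m - 1)
    have hzz := hz x hx i
    have hgg := coordNorm_fderiv_linComb_sub_le (r := R i) (r' := R' i) (h.augment hG)
      (h'.augment hG) (hc.augment he hD) hx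
    have hg' : coordNorm (fderiv ℝ (linComb (R' i) (_root_.augment H')) x) ≤ G :=
      (coordNorm_fderiv_linComb_le (h'.augment hG) hx).trans (mul_le_of_le_one_left hG (hR' i))
    set z := linComb (R i) (_root_.augment H) x
    set z' := linComb (R' i) (_root_.augment H') x
    set φ := fderiv ℝ (linComb (R i) (_root_.augment H)) x
    set φ' := fderiv ℝ (linComb (R' i) (_root_.augment H')) x
    have h0 : 0 ≤ max z 0 ^ (m - 1) := pow_nonneg (le_max_right _ _) _
    have hφ : coordNorm (φ - φ') ≤ D + (e + ε) * G := by
      refine hgg.trans (add_le_add (mul_le_of_le_one_left hD (hR i)) ?_)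
      exact mul_le_mul_of_nonneg_right ((hRR i).trans (by linarith)) hG
    have hsplit : ((m : ℝ) * max z 0 ^ (m - 1)) • φ - ((m : ℝ) * max z' 0 ^ (m - 1)) • φ'
        = ((m : ℝ) * max z 0 ^ (m - 1)) • (φ - φ')
          + ((m : ℝ) * (max z 0 ^ (m - 1) - max z' 0 ^ (m - 1))) • φ' := by
      module
    have hm1 : ((m - 1 : ℕ) : ℝ) = m - 1 := by
      rw [Nat.cast_sub (by omega), Nat.cast_one]
    have hm0 : (0 : ℝ) ≤ m - 1 := by rw [← hm1]; positivity
    rw [hm1] at hpp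
    rw [hsplit]
    refine (coordNorm_add_le _ _).trans ?_
    rw [coordNorm_smul, coordNorm_smul, abs_of_nonneg (by positivity), abs_mul, Nat.abs_cast]
    calc (m : ℝ) * max z 0 ^ (m - 1) * coordNorm (φ - φ')
          + m * |max z 0 ^ (m - 1) - max z' 0 ^ (m - 1)| * coordNorm φ'
        ≤ m * 1 * (D + (e + ε) * G) + m * ((m - 1) * (e + ε)) * G := by
          have hb := hpp.trans (mul_le_mul_of_nonneg_left hzz hm0)
          have h0' := coordNorm_nonneg (φ - φ')
          have h0'' := coordNorm_nonneg φ'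
          have hb0 := (abs_nonneg _).trans hb
          gcongr
      _ = m * D + m ^ 2 * G * (e + ε) := by ring

end Layer

theorem exists_abs_sub_nat_mul_le {δ : ℝ} (hδ : 0 < δ) (w : ℝ) :
    ∃ p : Bool × ℕ, p.2 * δ ≤ |w| ∧ |w - (if p.1 then p.2 * δ else -(p.2 * δ))| ≤ δ := by
  have h1 : (⌊|w| / δ⌋₊ : ℝ) * δ ≤ |w| :=
    (le_div_iff₀ hδ).1 (Nat.floor_le (by positivity))
  have h2 : |w| ≤ (⌊|w| / δ⌋₊ : ℝ) * δ + δ := by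
    have := (div_lt_iff₀ hδ).1 (Nat.lt_floor_add_one (|w| / δ))
    linarith
  refine ⟨(decide (0 ≤ w), ⌊|w| / δ⌋₊), h1, ?_⟩
  rcases le_or_gt 0 w with hw | hw
  · simp only [hw, decide_true, if_true]
    rw [abs_of_nonneg hw] at h1 h2 ⊢
    rw [abs_le]; constructor <;> linarith
  · simp only [not_le.2 hw, decide_false, Bool.false_eq_true, if_false]
    rw [abs_of_neg hw] at h1 h2 ⊢
    rw [abs_le]; constructor <;> linarith

/-- The number of signed integer vectors in an `ℓ¹`-ball of radius proportional to the
dimension. -/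
theorem card_filter_sum_le {ι : Type*} [Fintype ι] [DecidableEq ι] {ε : ℝ} (hε : 0 < ε)
    (hε1 : ε ≤ 1) (N : ℕ) :
    (((Fintype.piFinset fun _ : ι => (Finset.univ : Finset Bool) ×ˢ Finset.range N).filter
      fun p => ε * ∑ j, ((p j).2 : ℝ) ≤ Fintype.card ι).card : ℝ)
      ≤ (12 / ε) ^ Fintype.card ι := by
  set P := Fintype.piFinset fun _ : ι => (Finset.univ : Finset Bool) ×ˢ Finset.range N
  set q : ℝ := (1 + ε)⁻¹ with hq
  have hq0 : 0 < q := by positivity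
  have hq1 : q < 1 := inv_lt_one_of_one_lt₀ (by linarith)
  have hone : ∀ p : ι → Bool × ℕ, ε * ∑ j, ((p j).2 : ℝ) ≤ Fintype.card ι →
      1 ≤ 3 ^ Fintype.card ι * ∏ j, q ^ (p j).2 := by
    intro p hp
    rw [Finset.prod_pow_eq_pow_sum, hq, inv_pow, ← div_eq_mul_inv, one_le_div (by positivity)]
    calc (1 + ε) ^ (∑ j, (p j).2) ≤ Real.exp ε ^ (∑ j, (p j).2) := by
          gcongr; linarith [Real.add_one_le_exp ε]
      _ = Real.exp (ε * ∑ j, ((p j).2 : ℝ)) := by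
          rw [← Real.exp_nat_mul]; push_cast; rw [mul_comm]
      _ ≤ Real.exp (Fintype.card ι * 1) := by rw [mul_one]; exact Real.exp_le_exp.2 hp
      _ = Real.exp 1 ^ Fintype.card ι := Real.exp_nat_mul _ _
      _ ≤ 3 ^ Fintype.card ι := by gcongr; linarith [Real.exp_one_lt_d9]
  have hgeom : ∑ a ∈ Finset.range N, q ^ a ≤ 2 / ε := by
    have hsum := (summable_geometric_of_lt_one hq0.le hq1).sum_le_tsum (Finset.range N)
      fun _ _ => by positivity
    rw [tsum_geometric_of_lt_one hq0.le hq1] at hsum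
    refine hsum.trans ?_
    have : 1 - q = ε / (1 + ε) := by rw [hq]; field_simp; ring
    rw [this, inv_div]
    gcongr
    linarith
  calc ((P.filter fun p => ε * ∑ j, ((p j).2 : ℝ) ≤ Fintype.card ι).card : ℝ)
      = ∑ p ∈ P.filter (fun p => ε * ∑ j, ((p j).2 : ℝ) ≤ Fintype.card ι), (1 : ℝ) := by simp
    _ ≤ ∑ p ∈ P.filter (fun p => ε * ∑ j, ((p j).2 : ℝ) ≤ Fintype.card ι),
          3 ^ Fintype.card ι * ∏ j, q ^ (p j).2 :=
        Finset.sum_le_sum fun p hp => hone p (Finset.mem_filter.1 hp).2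
    _ ≤ ∑ p ∈ P, 3 ^ Fintype.card ι * ∏ j, q ^ (p j).2 :=
        Finset.sum_le_sum_of_subset_of_nonneg (Finset.filter_subset _ _)
          fun _ _ _ => by positivity
    _ = 3 ^ Fintype.card ι *
          ∏ _j : ι, ∑ c ∈ (Finset.univ : Finset Bool) ×ˢ Finset.range N, q ^ c.2 := by
        rw [← Finset.mul_sum, Finset.prod_univ_sum]
    _ = 3 ^ Fintype.card ι * (2 * ∑ a ∈ Finset.range N, q ^ a) ^ Fintype.card ι := by
        rw [Finset.prod_const, Finset.card_univ, Finset.sum_product]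
        simp
    _ ≤ 3 ^ Fintype.card ι * (2 * (2 / ε)) ^ Fintype.card ι := by gcongr
    _ = (12 / ε) ^ Fintype.card ι := by rw [← mul_pow]; congr 1; ring

/-- Dimension-free covering of the `ℓ¹` unit ball: the base of the exponential does not depend on
the dimension. -/
theorem exists_finset_cover_l1_ball (ι : Type*) [Fintype ι] {ε : ℝ} (hε : 0 < ε) (hε1 : ε ≤ 1) :
    ∃ F : Finset (ι → ℝ), (F.card : ℝ) ≤ (12 / ε) ^ Fintype.card ι ∧
      (∀ v ∈ F, ∑ j, |v j| ≤ 1) ∧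
      ∀ w : ι → ℝ, ∑ j, |w j| ≤ 1 → ∃ v ∈ F, ∑ j, |w j - v j| ≤ ε := by
  classical
  rcases isEmpty_or_nonempty ι with hι | hι
  · exact ⟨{0}, by simp, by simp, fun w _ => ⟨0, by simp, by simpa using hε.le⟩⟩
  set n := Fintype.card ι with hn
  have hn0 : (0 : ℝ) < n := by exact_mod_cast Fintype.card_pos
  set δ := ε / n with hδ
  have hδ0 : 0 < δ := by positivity
  set N := ⌊n / ε⌋₊ + 1 with hN
  set Q := (Fintype.piFinset fun _ : ι => (Finset.univ : Finset Bool) ×ˢ Finset.range N).filter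
      fun p => ε * ∑ j, ((p j).2 : ℝ) ≤ Fintype.card ι with hQ
  set f : (ι → Bool × ℕ) → ι → ℝ :=
    fun p j => if (p j).1 then (p j).2 * δ else -((p j).2 * δ) with hf
  have hfabs : ∀ p j, |f p j| = (p j).2 * δ := by
    intro p j
    have h0 : 0 ≤ ((p j).2 : ℝ) * δ := by positivity
    simp only [hf]
    split_ifs
    · exact abs_of_nonneg h0
    · rw [abs_neg, abs_of_nonneg h0]
  have hscale : ∀ p : ι → Bool × ℕ, ∑ j, ((p j).2 : ℝ) * δ ≤ 1 ↔
      ε * ∑ j, ((p j).2 : ℝ) ≤ n := by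
    intro p
    rw [← Finset.sum_mul, hδ, ← mul_div_assoc, div_le_one hn0, mul_comm]
  refine ⟨Q.image f, ?_, ?_, ?_⟩
  · exact (Nat.cast_le.2 Finset.card_image_le).trans (card_filter_sum_le hε hε1 N)
  · intro v hv
    obtain ⟨p, hp, rfl⟩ := Finset.mem_image.1 hv
    simp only [hfabs]
    exact (hscale p).2 (Finset.mem_filter.1 hp).2
  · intro w hw
    choose p hp1 hp2 using fun j => exists_abs_sub_nat_mul_le hδ0 (w j)
    have hsum : ∑ j, ((p j).2 : ℝ) * δ ≤ 1 := (Finset.sum_le_sum fun j _ => hp1 j).trans hw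
    refine ⟨f p, Finset.mem_image_of_mem _ (Finset.mem_filter.2 ⟨?_, (hscale p).1 hsum⟩), ?_⟩
    · refine Fintype.mem_piFinset.2 fun j => Finset.mem_product.2 ⟨Finset.mem_univ _, ?_⟩
      have hj : ((p j).2 : ℝ) * δ ≤ 1 :=
        (Finset.single_le_sum (f := fun j => ((p j).2 : ℝ) * δ)
          (fun i _ => by positivity) (Finset.mem_univ j)).trans hsum
      have hj' : ((p j).2 : ℝ) ≤ n / ε := by
        rw [hδ] at hj
        rw [le_div_iff₀ hε]
        rwa [← mul_div_assoc, div_le_one hn0] at hj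
      exact Finset.mem_range.2 (Nat.lt_succ_of_le (Nat.le_floor hj'))
    · calc ∑ j, |w j - f p j| ≤ ∑ _j : ι, δ := Finset.sum_le_sum fun j _ => hp2 j
        _ = ε := by
          rw [Finset.sum_const, Finset.card_univ, nsmul_eq_mul, ← hn, hδ]
          field_simp

theorem FamilyClose.mono {d : ℕ} {ι : Type*} {e e' D D' : ℝ} {H H' : (Fin d → ℝ) → ι → ℝ}
    (h : FamilyClose e D H H') (he : e ≤ e') (hD : D ≤ D') : FamilyClose e' D' H H' :=
  ⟨fun x hx j => (h.abs_le x hx j).trans he, fun x hx j => (h.grad_le x hx j).trans hD⟩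

theorem coordNorm_proj {d : ℕ} (j : Fin d) :
    coordNorm (ContinuousLinearMap.proj (R := ℝ) (φ := fun _ : Fin d => ℝ) j) = 1 := by
  rw [coordNorm, Finset.sum_eq_single j]
  · simp
  · intro i _ hi
    simp [hi.symm]
  · simp

theorem isBoundedFamily_id (d : ℕ) : IsBoundedFamily (d := d) 1 fun x => x where
  contDiff j := contDiff_apply ℝ ℝ j
  abs_le x hx j := abs_le.2 ⟨by linarith [show (0 : ℝ) ≤ x j from hx.1 j], hx.2 j⟩
  grad_le x _ j := by
    have h : HasFDerivAt (fun y : Fin d → ℝ => y j)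
        (ContinuousLinearMap.proj (R := ℝ) (φ := fun _ : Fin d => ℝ) j) x :=
      hasFDerivAt_apply j x
    rw [h.fderiv, coordNorm_proj]

theorem repu_mul {m : ℕ} {c : ℝ} (hc : 0 ≤ c) (t : ℝ) : repu m (c * t) = c ^ m * repu m t := by
  rw [repu, repu, ← mul_pow, mul_max_of_nonneg _ _ hc, mul_zero]

theorem row_sum_le_augInfNorm {p q : ℕ} (A : Matrix (Fin p) (Fin q) ℝ) (b : Fin p → ℝ)
    (i : Fin p) : (∑ j, |A i j|) + |b i| ≤ augInfNorm A b :=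
  le_ciSup (f := fun i => (∑ j, |A i j|) + |b i|) (Set.finite_range _).bddAbove i

theorem row_sum_le_matInfNorm {p q : ℕ} (A : Matrix (Fin p) (Fin q) ℝ) (i : Fin p) :
    ∑ j, |A i j| ≤ matInfNorm A :=
  le_ciSup (f := fun i => ∑ j, |A i j|) (Set.finite_range _).bddAbove i

/-- The factor by which the first `s` layers can be rescaled to have norm at most `1`. -/
noncomputable def hiddenScale (m : ℕ) (arch : ℕ → ℕ)
    (A : ∀ ℓ : ℕ, Matrix (Fin (arch (ℓ + 1))) (Fin (arch ℓ)) ℝ)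
    (b : ∀ ℓ : ℕ, Fin (arch (ℓ + 1)) → ℝ) (s : ℕ) : ℝ :=
  ∏ t ∈ Finset.range s, (max (augInfNorm (A t) (b t)) 1) ^ (m ^ (s - t))

section Scale

variable {m : ℕ} {arch : ℕ → ℕ} {A : ∀ ℓ : ℕ, Matrix (Fin (arch (ℓ + 1))) (Fin (arch ℓ)) ℝ}
  {b : ∀ ℓ : ℕ, Fin (arch (ℓ + 1)) → ℝ}

theorem one_le_hiddenScale (s : ℕ) : 1 ≤ hiddenScale m arch A b s :=
  Finset.prod_induction _ (1 ≤ ·) (fun _ _ => one_le_mul_of_one_le_of_one_le) le_rfl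
    fun _ _ => one_le_pow₀ (le_max_right _ _)

theorem hiddenScale_succ (s : ℕ) : hiddenScale m arch A b (s + 1)
    = (hiddenScale m arch A b s * max (augInfNorm (A s) (b s)) 1) ^ m := by
  rw [hiddenScale, hiddenScale, Finset.prod_range_succ, mul_pow, ← Finset.prod_pow]
  congr 1
  · refine Finset.prod_congr rfl fun t ht => ?_
    rw [← pow_mul, ← pow_succ, Nat.succ_sub (Finset.mem_range.1 ht).le]
  · simp

theorem netFwd_succ_eq_smul {s : ℕ} {H : (Fin (arch 0) → ℝ) → Fin (arch s) → ℝ}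
    (hH : ∀ x, netFwd m arch A b x s = hiddenScale m arch A b s • H x) :
    ∃ R : Fin (arch (s + 1)) → Option (Fin (arch s)) → ℝ, (∀ i, ∑ o, |R i o| ≤ 1) ∧
      ∀ x, netFwd m arch A b x (s + 1) = hiddenScale m arch A b (s + 1) • repuLayer m R H x := by
  set c := hiddenScale m arch A b s with hc
  set M := max (augInfNorm (A s) (b s)) 1 with hM
  have hc1 : 1 ≤ c := one_le_hiddenScale s
  have hM1 : 1 ≤ M := le_max_right _ _
  refine ⟨fun i o => o.elim (b s i / (c * M)) fun j => A s i j / M, fun i => ?_, fun x => ?_⟩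
  · simp only [Fintype.sum_option, Option.elim]
    have hrow : (∑ j, |A s i j|) + |b s i| ≤ M :=
      (row_sum_le_augInfNorm _ _ i).trans (le_max_left _ _)
    have hb : |b s i / (c * M)| ≤ |b s i| / M := by
      rw [abs_div, abs_of_pos (by positivity : 0 < c * M)]
      gcongr
      exact le_mul_of_one_le_left (by positivity) hc1
    have hA : ∑ j, |A s i j / M| = (∑ j, |A s i j|) / M := by
      simp only [abs_div, abs_of_pos (by positivity : 0 < M), Finset.sum_div]
    rw [hA]
    calc |b s i / (c * M)| + (∑ j, |A s i j|) / M ≤ |b s i| / M + (∑ j, |A s i j|) / M := by gcongr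
      _ = ((∑ j, |A s i j|) + |b s i|) / M := by ring
      _ ≤ 1 := (div_le_one (by positivity)).2 hrow
  · funext i
    rw [Pi.smul_apply, smul_eq_mul, hiddenScale_succ, ← hc, ← hM, repuLayer,
      ← repu_mul (by positivity), netFwd, hH x]
    refine congrArg (repu m) ?_
    simp only [linComb, augment, Fintype.sum_option, Option.elim, Matrix.mulVec, dotProduct,
      Pi.smul_apply, smul_eq_mul, mul_add, Finset.mul_sum]
    rw [add_comm]
    refine congrArg₂ (· + ·) ?_ ?_
    · field_simp
    · refine Finset.sum_congr rfl fun j _ => ?_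
      field_simp

theorem sum_abs_outputRow_le {L : ℕ} (hL : arch (L + 1) = 1) :
    ∑ j, |∑ i, A L i j| ≤ matInfNorm (A L) := by
  obtain ⟨i₀, hi₀⟩ := Finset.card_eq_one.1
    (show (Finset.univ : Finset (Fin (arch (L + 1)))).card = 1 by simpa using hL)
  simpa [hi₀] using row_sum_le_matInfNorm (A L) i₀

end Scale

theorem exists_cover_netFwd {m : ℕ} (hm : 2 ≤ m) {ε : ℝ} (hε : 0 < ε) (hε1 : ε ≤ 1)
    (arch : ℕ → ℕ) (s : ℕ) :
    ∃ T : Finset ((Fin (arch 0) → ℝ) → Fin (arch s) → ℝ),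
      (∀ h ∈ T, IsBoundedFamily ((m : ℝ) ^ s) h) ∧
      (T.card : ℝ) ≤ (12 / ε) ^ netSize arch s ∧
      ∀ A b, ∃ H, IsBoundedFamily ((m : ℝ) ^ s) H ∧
        (∀ x, netFwd m arch A b x s = hiddenScale m arch A b s • H x) ∧
        ∃ h ∈ T, FamilyClose ((2 * (m : ℝ) ^ s - 2) * ε) (4 * (m : ℝ) ^ (2 * s) * ε) H h := by
  classical
  have hm2 : (2 : ℝ) ≤ m := by exact_mod_cast hm
  induction s with
  | zero =>
    refine ⟨{fun x => x}, ?_, by simp [netSize], fun A b => ⟨fun x => x, ?_, ?_, ?_⟩⟩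
    · simpa using isBoundedFamily_id (arch 0)
    · simpa using isBoundedFamily_id (arch 0)
    · intro x
      simp [netFwd, hiddenScale]
    · refine ⟨_, Finset.mem_singleton_self _, fun x _ j => by simp, fun x _ j => ?_⟩
      rw [sub_self, coordNorm_zero]
      positivity
  | succ s ih =>
    obtain ⟨T, hT, hcard, hcov⟩ := ih
    obtain ⟨F, hFcard, hF1, hFcov⟩ := exists_finset_cover_l1_ball (Option (Fin (arch s))) hε hε1
    have hpow : (1 : ℝ) ≤ (m : ℝ) ^ s := one_le_pow₀ (by linarith)
    refine ⟨(Fintype.piFinset (fun _ : Fin (arch (s + 1)) => F) ×ˢ T).image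
      fun p => repuLayer m p.1 p.2, ?_, ?_, fun A b => ?_⟩
    · intro h hh
      obtain ⟨⟨R, h0⟩, hp, rfl⟩ := Finset.mem_image.1 hh
      obtain ⟨hR, hh0⟩ := Finset.mem_product.1 hp
      rw [pow_succ']
      exact (hT h0 hh0).repuLayer hm (by positivity)
        fun i => hF1 _ (Fintype.mem_piFinset.1 hR i)
    · refine (Nat.cast_le.2 Finset.card_image_le).trans ?_
      rw [Finset.card_product, Fintype.card_piFinset_const, Nat.cast_mul, Nat.cast_pow,
        netSize, Finset.sum_range_succ, pow_add, mul_comm]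
      simp only [Fintype.card_option, Fintype.card_fin] at hFcard
      rw [mul_comm (arch (s + 1)), pow_mul]
      refine mul_le_mul hcard ?_ (by positivity) (by positivity)
      gcongr
    · obtain ⟨H, hHb, hHeq, h, hh, hclose⟩ := hcov A b
      obtain ⟨R, hR, hReq⟩ := netFwd_succ_eq_smul hHeq
      choose R' hR'F hR' using fun i => hFcov (R i) (hR i)
      refine ⟨repuLayer m R H, ?_, hReq, repuLayer m R' h, ?_, ?_⟩
      · rw [pow_succ']
        exact hHb.repuLayer hm (by positivity) hR
      · exact Finset.mem_image.2
          ⟨(R', h), Finset.mem_product.2 ⟨Fintype.mem_piFinset.2 hR'F, hh⟩, rfl⟩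
      · refine (FamilyClose.repuLayer hm (by positivity) (mul_nonneg (by linarith) hε.le)
          (by positivity) hHb (hT h hh) hclose hR (fun i => hF1 _ (hR'F i)) hR').mono ?_ ?_
        · rw [pow_succ]
          nlinarith
        · have h2s : (m : ℝ) ^ (2 * s) = (m : ℝ) ^ s * (m : ℝ) ^ s := by rw [two_mul, pow_add]
          have h2s' : (m : ℝ) ^ (2 * (s + 1)) = m ^ 2 * ((m : ℝ) ^ s * (m : ℝ) ^ s) := by
            rw [← h2s, ← pow_add]; congr 1; ring
          rw [h2s, h2s']
          set P := (m : ℝ) ^ s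
          have h1 : 0 ≤ m * (m - 2) * (P * P * ε) :=
            mul_nonneg (mul_nonneg (by positivity) (by linarith)) (by positivity)
          have h2 : 0 ≤ (m : ℝ) ^ 2 * P * ε := by positivity
          nlinarith

theorem exists_linComb_of_mem_NNclassArch {m L : ℕ} (hm : 2 ≤ m) {arch : ℕ → ℕ}
    (hL : arch (L + 1) = 1) {A : ∀ ℓ : ℕ, Matrix (Fin (arch (ℓ + 1))) (Fin (arch ℓ)) ℝ}
    {b : ∀ ℓ : ℕ, Fin (arch (ℓ + 1)) → ℝ} {K : ℝ} (hK : kappa m L arch A b ≤ K)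
    {H : (Fin (arch 0) → ℝ) → Fin (arch L) → ℝ}
    (hH : ∀ x, netFwd m arch A b x L = hiddenScale m arch A b L • H x) :
    ∃ v : Fin (arch L) → ℝ, ∑ j, |v j| ≤ K / (m : ℝ) ^ L ∧ netOut m arch A b L = linComb v H := by
  have hm0 : (0 : ℝ) < m := by exact_mod_cast (by omega : 0 < m)
  have hc := one_le_hiddenScale (m := m) (A := A) (b := b) L
  refine ⟨fun j => hiddenScale m arch A b L * ∑ i, A L i j, ?_, ?_⟩
  · simp only [abs_mul, ← Finset.mul_sum, abs_of_nonneg (zero_le_one.trans hc)]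
    rw [le_div_iff₀ (by positivity)]
    refine le_trans ?_ hK
    rw [kappa, ← hiddenScale]
    have := sum_abs_outputRow_le (A := A) hL
    calc hiddenScale m arch A b L * (∑ j, |∑ i, A L i j|) * (m : ℝ) ^ L
        ≤ hiddenScale m arch A b L * matInfNorm (A L) * (m : ℝ) ^ L := by gcongr
      _ = _ := by ring
  · funext x
    simp only [netOut, linComb, hH x, Matrix.mulVec, dotProduct, Pi.smul_apply, smul_eq_mul]
    rw [Finset.sum_comm]
    refine Finset.sum_congr rfl fun j _ => ?_
    rw [← Finset.sum_mul]
    ring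

theorem arch_le_netSize {arch : ℕ → ℕ} {L : ℕ} (hL : 1 ≤ L) : arch L ≤ netSize arch L := by
  obtain ⟨k, rfl⟩ := Nat.exists_eq_add_of_le' hL
  rw [netSize, Finset.sum_range_succ]
  nlinarith [Nat.zero_le (∑ s ∈ Finset.range k, arch (s + 1) * (arch s + 1)),
    Nat.zero_le (arch (k + 1) * arch k)]

theorem netOut_small {m L : ℕ} (hm : 2 ≤ m) {arch : ℕ → ℕ} (hL : arch (L + 1) = 1) {K : ℝ}
    (hK : 0 < K) {g : (Fin (arch 0) → ℝ) → ℝ} (hg : g ∈ NNclassArch m L arch K)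
    {x : Fin (arch 0) → ℝ} (hx : x ∈ Set.Icc (0 : Fin (arch 0) → ℝ) 1) :
    |g x| + coordNorm (fderiv ℝ g x) ≤ 2 * K := by
  have hpow : (1 : ℝ) ≤ (m : ℝ) ^ L := one_le_pow₀ (by exact_mod_cast (by omega : 1 ≤ m))
  obtain ⟨A, b, hAb, rfl⟩ := hg
  obtain ⟨T, -, -, hT⟩ := exists_cover_netFwd hm zero_lt_one le_rfl arch L
  obtain ⟨H, hHb, hHeq, -⟩ := hT A b
  obtain ⟨v, hv, hvH⟩ := exists_linComb_of_mem_NNclassArch hm hL hAb hHeq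
  have h1 := (abs_linComb_le (r := v) hHb hx).trans (hv.trans (div_le_self hK.le hpow))
  have h2 : coordNorm (fderiv ℝ (linComb v H) x) ≤ K := by
    refine (coordNorm_fderiv_linComb_le hHb hx).trans ?_
    rwa [← le_div_iff₀ (by positivity)]
  rw [hvH]
  linarith

theorem exists_cover_NNclassArch {m L : ℕ} (hm : 2 ≤ m) {arch : ℕ → ℕ} (hL1 : 1 ≤ L)
    (hL : arch (L + 1) = 1) {K ε : ℝ} (hK : 0 < K) (hε : 0 < ε) (hε1 : ε ≤ 1) :
    ∃ T : Finset ((Fin (arch 0) → ℝ) → ℝ),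
      (∀ h ∈ T, ContDiff ℝ 1 h) ∧ (T.card : ℝ) ≤ (12 / ε) ^ (2 * netSize arch L) ∧
      ∀ g ∈ NNclassArch m L arch K, ∃ g' ∈ T, ∀ x ∈ Set.Icc (0 : Fin (arch 0) → ℝ) 1,
        |g x - g' x| + coordNorm (fderiv ℝ g x - fderiv ℝ g' x) ≤ 7 * K * (m : ℝ) ^ L * ε := by
  classical
  have hm1 : (1 : ℝ) ≤ m := by exact_mod_cast (by omega : 1 ≤ m)
  obtain ⟨T, hT, hcard, hcov⟩ := exists_cover_netFwd hm hε hε1 arch L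
  obtain ⟨F, hFcard, hF1, hFcov⟩ := exists_finset_cover_l1_ball (Fin (arch L)) hε hε1
  set P := (m : ℝ) ^ L with hP
  have hpow : 1 ≤ P := one_le_pow₀ hm1
  set ρ := K / P with hρ
  have hρ0 : 0 < ρ := by positivity
  refine ⟨(F ×ˢ T).image fun p => linComb (ρ • p.1) p.2, ?_, ?_, ?_⟩
  · intro h hh
    obtain ⟨⟨v, h0⟩, hp, rfl⟩ := Finset.mem_image.1 hh
    exact contDiff_linComb (hT h0 (Finset.mem_product.1 hp).2)
  · refine (Nat.cast_le.2 Finset.card_image_le).trans ?_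
    rw [Finset.card_product, Nat.cast_mul, two_mul, pow_add]
    refine mul_le_mul (hFcard.trans ?_) hcard (by positivity) (by positivity)
    rw [Fintype.card_fin]
    exact pow_le_pow_right₀ ((one_le_div hε).2 (by linarith)) (arch_le_netSize hL1)
  · rintro g ⟨A, b, hAb, rfl⟩
    obtain ⟨H, hHb, hHeq, h, hh, hclose⟩ := hcov A b
    obtain ⟨v, hv, hvH⟩ := exists_linComb_of_mem_NNclassArch hm hL hAb hHeq
    obtain ⟨w, hwF, hw⟩ := hFcov (ρ⁻¹ • v) (by
      simp only [Pi.smul_apply, smul_eq_mul, abs_mul, ← Finset.mul_sum,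
        abs_of_pos (inv_pos.2 hρ0)]
      rwa [inv_mul_le_iff₀ hρ0, mul_one])
    have hvw : ∑ j, |v j - (ρ • w) j| ≤ ρ * ε := by
      refine le_of_eq_of_le ?_ (mul_le_mul_of_nonneg_left hw hρ0.le)
      rw [Finset.mul_sum]
      refine Finset.sum_congr rfl fun j _ => ?_
      rw [← abs_of_pos hρ0, ← abs_mul, abs_of_pos hρ0]
      simp only [Pi.smul_apply, smul_eq_mul]
      congr 1
      field_simp
    refine ⟨linComb (ρ • w) h, Finset.mem_image.2 ⟨(w, h), Finset.mem_product.2 ⟨hwF, hh⟩, rfl⟩,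
      fun x hx => ?_⟩
    rw [hvH]
    have h1 := abs_linComb_sub_le (r := v) (r' := ρ • w) (hT h hh) hclose hx
    have h2 := coordNorm_fderiv_linComb_sub_le (r := v) (r' := ρ • w) hHb (hT h hh) hclose hx
    have h2L : (m : ℝ) ^ (2 * L) = P * P := by rw [two_mul, pow_add]
    rw [h2L] at h2
    have he : 0 ≤ (2 * P - 2) * ε := mul_nonneg (by linarith) hε.le
    have h1' : |linComb v H x - linComb (ρ • w) h x| ≤ ρ * ((2 * P - 2) * ε) + ρ * ε :=
      h1.trans (add_le_add (mul_le_mul_of_nonneg_right hv he) hvw)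
    have h2' : coordNorm (fderiv ℝ (linComb v H) x - fderiv ℝ (linComb (ρ • w) h) x)
        ≤ ρ * (4 * (P * P) * ε) + ρ * ε * P :=
      h2.trans (add_le_add (mul_le_mul_of_nonneg_right hv (by positivity))
        (mul_le_mul_of_nonneg_right hvw (by positivity)))
    have hρP : K = ρ * P := by rw [hρ]; field_simp
    have hρε : 0 < ρ * ε := by positivity
    rw [hρP]
    nlinarith [mul_nonneg hρε.le (mul_nonneg (zero_le_one.trans hpow) (sub_nonneg.2 hpow))]

/-- Covering bound for norm-constrained RePU networks (`m ≥ 2`) in the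
metric `ρ_∞(g, g̃) = sup_{x ∈ [0,1]^d} (|g(x) − g̃(x)| + ‖∇g(x) − ∇g̃(x)‖₁)`:
there is a constant `C > 0` depending only on `m` such that `𝒩_K` admits a `u`-cover of
continuously differentiable functions of cardinality at most
`exp(C · 𝒮 · log(1 + L·K·m^L/u))`. -/
theorem stmt6 (m : ℕ) (hm : 2 ≤ m) :
    ∃ C : ℝ, 0 < C ∧
      ∀ (d L : ℕ), 0 < d → 1 ≤ L →
      ∀ arch : ℕ → ℕ, arch 0 = d → arch (L + 1) = 1 →
      ∀ K u : ℝ, 0 < K → 0 < u →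
      ∃ T : Finset ((Fin (arch 0) → ℝ) → ℝ),
        (∀ h ∈ T, ContDiff ℝ 1 h) ∧
        (T.card : ℝ) ≤ Real.exp (C * (netSize arch L : ℝ)
            * Real.log (1 + (L : ℝ) * K * (m : ℝ) ^ L / u)) ∧
        ∀ g ∈ NNclassArch m L arch K, ∃ g' ∈ T,
          ∀ x ∈ Set.Icc (0 : Fin (arch 0) → ℝ) 1,
            |g x - g' x|
              + ∑ i, |fderiv ℝ g x (Pi.single i 1) - fderiv ℝ g' x (Pi.single i 1)| ≤ u := by
  refine ⟨16, by norm_num, fun d L _ hL1 arch _ hL K u hK hu => ?_⟩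
  have hm1 : (1 : ℝ) ≤ m := by exact_mod_cast (by omega : 1 ≤ m)
  have hm2 : (2 : ℝ) ≤ m := by exact_mod_cast hm
  have hLr : (1 : ℝ) ≤ L := by exact_mod_cast hL1
  set X := (L : ℝ) * K * (m : ℝ) ^ L / u with hX
  have hX0 : 0 < X := by positivity
  rcases le_or_gt (2 * K) u with hKu | hKu
  · refine ⟨{fun _ => 0}, ?_, ?_, fun g hg => ⟨_, Finset.mem_singleton_self _, fun x hx => ?_⟩⟩
    · intro h hh
      rw [Finset.mem_singleton.1 hh]
      exact contDiff_const
    · have hlog : 0 ≤ Real.log (1 + X) := Real.log_nonneg (by linarith)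
      simpa using (by positivity : 0 ≤ 16 * (netSize arch L : ℝ) * Real.log (1 + X))
    · simpa [coordNorm] using (netOut_small hm hL hK hg hx).trans hKu
  · have hpow : (2 : ℝ) ≤ (m : ℝ) ^ L :=
      hm2.trans (le_self_pow₀ hm1 (by omega))
    set ε := u / (7 * K * (m : ℝ) ^ L) with hε
    have hε0 : 0 < ε := by positivity
    have hε1 : ε ≤ 1 := by
      rw [hε, div_le_one (by positivity)]
      nlinarith
    obtain ⟨T, hT, hcard, hcov⟩ := exists_cover_NNclassArch (arch := arch) hm hL1 hL hK hε0 hε1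
    refine ⟨T, hT, hcard.trans ?_, fun g hg => ?_⟩
    · have hXu : K * (m : ℝ) ^ L / u ≤ X := by
        rw [hX]
        gcongr
        exact le_mul_of_one_le_left (by positivity) hLr
      have hX1 : 1 ≤ X := by
        refine le_trans ?_ hXu
        rw [one_le_div hu]
        nlinarith
      have hbase : 12 / ε ≤ (1 + X) ^ 8 :=
        calc 12 / ε = 84 * (K * (m : ℝ) ^ L / u) := by rw [hε]; field_simp; norm_num
          _ ≤ 2 ^ 7 * (1 + X) := by linarith
          _ ≤ (1 + X) ^ 7 * (1 + X) := by gcongr; linarith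
          _ = (1 + X) ^ 8 := by ring
      calc (12 / ε) ^ (2 * netSize arch L) ≤ ((1 + X) ^ 8) ^ (2 * netSize arch L) := by gcongr
        _ = (1 + X) ^ (16 * netSize arch L) := by rw [← pow_mul]; congr 1; ring
        _ = Real.exp (Real.log (1 + X)) ^ (16 * netSize arch L) := by
          rw [Real.exp_log (by linarith)]
        _ = Real.exp (16 * (netSize arch L : ℝ) * Real.log (1 + X)) := by
          rw [← Real.exp_nat_mul]; push_cast; rfl
    · obtain ⟨g', hg', hle⟩ := hcov g hg
      refine ⟨g', hg', fun x hx => (hle x hx).trans_eq ?_⟩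
      rw [hε]
      field_simp
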